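/- A language L of nonempty words over a finite alphabet Σ is accepted by some sequential synchronous rational graph between rational sets of initial and final vertices if and only if L is the word language of some tiling system; in particular, for every tiling system S there exist a sequential synchronous rational graph G and rational sets I and F such that L(G,I,F) = L(S). -/

import Mathlib

/-!  Common definitions: transducers, rational graphs, regular languages,
pictures and tiling systems, following Carayol & Meyer,
"Context-Sensitive Languages, Rational Graphs and Determinism". -/

/-- A set of words is regular (rational) if it is recognized by a finite automaton. -/
def Regular {Γ : Type} (L : Set (List Γ)) : Prop :=
  ∃ (Q : Type) (_ : Fintype Q) (M : DFA Γ Q), M.accepts = L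

/-- A finite transducer over the alphabet `Γ`: a finite automaton whose
transitions are labeled by pairs in `(Γ ∪ {ε}) × (Γ ∪ {ε})`,
where `none` encodes the empty word ε. -/
structure Transducer (Γ : Type) where
  /-- states -/
  Q : Type
  /-- the set of states is finite -/
  fintypeQ : Fintype Q
  /-- initial state -/
  init : Q
  /-- final states -/
  final : Set Q
  /-- transition relation -/
  trans : Q → Option Γ × Option Γ → Q → Prop

namespace Transducer

variable {Γ : Type}

/-- Paths in a transducer, recording the list of transition labels. -/
inductive Path (T : Transducer Γ) : T.Q → List (Option Γ × Option Γ) → T.Q → Prop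
  | nil (q : T.Q) : Path T q [] q
  | cons {q q' q'' : T.Q} {l : Option Γ × Option Γ} {ls : List (Option Γ × Option Γ)} :
      T.trans q l q' → Path T q' ls q'' → Path T q (l :: ls) q''

/-- Input word of a list of transition labels (concatenation of first components). -/
def ins (ls : List (Option Γ × Option Γ)) : List Γ := ls.flatMap fun l => l.1.toList

/-- Output word of a list of transition labels (concatenation of second components). -/
def outs (ls : List (Option Γ × Option Γ)) : List Γ := ls.flatMap fun l => l.2.toList

/-- The binary relation on `Γ*` recognized by the transducer: pairs `(u,v)`
obtained by concatenating componentwise the labels along an accepting run. -/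
def Accepts (T : Transducer Γ) (u v : List Γ) : Prop :=
  ∃ (q : T.Q) (ls : List (Option Γ × Option Γ)),
    T.Path T.init ls q ∧ q ∈ T.final ∧ ins ls = u ∧ outs ls = v

/-- A transducer is synchronous if all its transitions are labeled by pairs
of letters of `Γ` (no ε). -/
def Synchronous (T : Transducer Γ) : Prop :=
  ∀ (q q' : T.Q) (l : Option Γ × Option Γ), T.trans q l q' → l.1.isSome ∧ l.2.isSome

/-- A transducer is (left-)synchronized if every path from the initial state
consists of a prefix of transitions labeled by pairs of letters of `Γ`,
followed by transitions which are all ε on the input side, or all ε on the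
output side. -/
def Synchronized (T : Transducer Γ) : Prop :=
  ∀ (q : T.Q) (ls : List (Option Γ × Option Γ)), T.Path T.init ls q →
    ∃ k : ℕ, (∀ l ∈ ls.take k, l.1.isSome ∧ l.2.isSome) ∧
      ((∀ l ∈ ls.drop k, l.1 = none) ∨ (∀ l ∈ ls.drop k, l.2 = none))

/-- A transducer is sequential if for any two transitions from a common state,
either they coincide, or their input letters are distinct letters of `Γ`. -/
def Sequential (T : Transducer Γ) : Prop :=
  ∀ (q q' q'' : T.Q) (x y x' y' : Option Γ),
    T.trans q (x, y) q' → T.trans q (x', y') q'' →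
    (x = x' ∧ y = y' ∧ q' = q'') ∨ (x ≠ none ∧ x' ≠ none ∧ x ≠ x')

/-- A transducer is deterministic if no two distinct transitions from the same
state carry the same label. -/
def Deterministic (T : Transducer Γ) : Prop :=
  ∀ (q q' q'' : T.Q) (l : Option Γ × Option Γ),
    T.trans q l q' → T.trans q l q'' → q' = q''

end Transducer

/-- A rational graph labeled by the alphabet `A` with vertices in `Γ*`,
given by one transducer over `Γ` per label. -/
structure RationalGraph (A Γ : Type) where
  /-- the transducer defining the edges labeled by a given letter -/
  trans : A → Transducer Γ

namespace RationalGraph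

variable {A Γ : Type}

/-- There is an edge `u →a v` iff `(u,v)` is recognized by the transducer `T_a`. -/
def Edge (G : RationalGraph A Γ) (u : List Γ) (a : A) (v : List Γ) : Prop :=
  (G.trans a).Accepts u v

/-- A synchronous rational graph is defined by synchronous transducers. -/
def Synchronous (G : RationalGraph A Γ) : Prop := ∀ a : A, (G.trans a).Synchronous

/-- A synchronized rational graph is defined by synchronized transducers. -/
def Synchronized (G : RationalGraph A Γ) : Prop := ∀ a : A, (G.trans a).Synchronized

/-- A sequential rational graph is defined by sequential transducers. -/
def Sequential (G : RationalGraph A Γ) : Prop := ∀ a : A, (G.trans a).Sequential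

/-- `vs` is the sequence of vertices of a path labeled by the word `w`. -/
def IsPath (G : RationalGraph A Γ) (vs : List (List Γ)) (w : List A) : Prop :=
  vs.length = w.length + 1 ∧
  ∀ (k : ℕ) (a : A) (u v : List Γ),
    w[k]? = some a → vs[k]? = some u → vs[k + 1]? = some v → G.Edge u a v

/-- The path language of `G` between the sets of vertices `I` and `F`:
all words labeling a path from a vertex of `I` to a vertex of `F`. -/
def Lang (G : RationalGraph A Γ) (I F : Set (List Γ)) : Set (List A) :=
  { w | ∃ (vs : List (List Γ)) (i f : List Γ), G.IsPath vs w ∧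
      vs.head? = some i ∧ i ∈ I ∧ vs.getLast? = some f ∧ f ∈ F }

/-- A graph has finite out-degree if every vertex has finitely many outgoing edges. -/
def FiniteOutDegree (G : RationalGraph A Γ) : Prop :=
  ∀ u : List Γ, { p : A × List Γ | G.Edge u p.1 p.2 }.Finite

/-- The out-degree of a vertex: the number of its outgoing edges. -/
noncomputable def outDegree (G : RationalGraph A Γ) (u : List Γ) : ℕ :=
  { p : A × List Γ | G.Edge u p.1 p.2 }.ncard

/-- Two vertices are adjacent if some edge (in either direction, ignoring
labels) connects them. -/
def Adj (G : RationalGraph A Γ) (u v : List Γ) : Prop :=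
  (∃ a, G.Edge u a v) ∨ (∃ a, G.Edge v a u)

end RationalGraph

/-- `chainN R n u v` holds iff there is a sequence of `n` `R`-steps from `u` to `v`. -/
def chainN {α : Type} (R : α → α → Prop) : ℕ → α → α → Prop
  | 0, u, v => u = v
  | n + 1, u, w => ∃ v, R u v ∧ chainN R n v w

/-- `IsDist R x v n` : the length of a shortest `R`-sequence from `x` to `v` is `n`. -/
def IsDist {α : Type} (R : α → α → Prop) (x v : α) (n : ℕ) : Prop :=
  chainN R n x v ∧ ∀ m : ℕ, chainN R m x v → n ≤ m

/-- A 2×2 tile over the alphabet `Λ`. -/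
structure Tile (Λ : Type) where
  /-- top-left letter -/
  tl : Λ
  /-- top-right letter -/
  tr : Λ
  /-- bottom-left letter -/
  bl : Λ
  /-- bottom-right letter -/
  br : Λ

/-- The set of 2×2 tiles appearing in a picture given as a list of rows. -/
def tilesOf {Λ : Type} (rows : List (List Λ)) : Set (Tile Λ) :=
  { t | ∃ (i j : ℕ) (r₁ r₂ : List Λ), rows[i]? = some r₁ ∧ rows[i + 1]? = some r₂ ∧
      r₁[j]? = some t.tl ∧ r₁[j + 1]? = some t.tr ∧
      r₂[j]? = some t.bl ∧ r₂[j + 1]? = some t.br }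

/-- The picture of width `m` framed by the border symbol `#` (encoded by `none`). -/
def framed {Λ : Type} (rows : List (List Λ)) (m : ℕ) : List (List (Option Λ)) :=
  List.replicate (m + 2) none ::
    (rows.map fun r => none :: (r.map some ++ [none])) ++
      [List.replicate (m + 2) none]

/-- A tiling system with input alphabet `A` and work alphabet `Λ`
(the frame symbol `#` is encoded by `none : Option Λ`). -/
structure TilingSystem (A Λ : Type) where
  /-- the embedding of the input alphabet into the work alphabet -/
  emb : A → Λ
  /-- the input alphabet is a sub-alphabet of the work alphabet -/
  emb_inj : Function.Injective emb
  /-- the (finite, as `Λ` is finite) set of allowed tiles over `Λ ∪ {#}` -/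
  tiles : Set (Tile (Option Λ))

namespace TilingSystem

variable {A Λ : Type}

/-- `S.Pic rows n m` : `rows` is an `(n,m)`-picture of the picture language of `S`,
i.e. all 2×2 tiles of the framed picture belong to the tiles of `S`. -/
def Pic (S : TilingSystem A Λ) (rows : List (List Λ)) (n m : ℕ) : Prop :=
  0 < n ∧ 0 < m ∧ rows.length = n ∧ (∀ r ∈ rows, r.length = m) ∧
    tilesOf (framed rows m) ⊆ S.tiles

/-- The word language of a tiling system: frontiers (first rows) of accepted
pictures that are words over the input alphabet. -/
def Lang (S : TilingSystem A Λ) : Set (List A) :=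
  { w | ∃ (rows : List (List Λ)) (n : ℕ),
      S.Pic rows n w.length ∧ rows.head? = some (w.map S.emb) }

/-- A tiling system is deterministic if each row determines at most one
possible next row. -/
def Deterministic (S : TilingSystem A Λ) : Prop :=
  ∀ u v v' : List (Option Λ), v.length = u.length → v'.length = u.length →
    tilesOf [none :: u ++ [none], none :: v ++ [none]] ⊆ S.tiles →
    tilesOf [none :: u ++ [none], none :: v' ++ [none]] ⊆ S.tiles → v = v'

end TilingSystem

/-! ## Functional descriptions -/

theorem RationalGraph.lang_fun {A Γ : Type} (G : RationalGraph A Γ) (I F : Set (List Γ))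
    (w : List A) : w ∈ G.Lang I F ↔ ∃ V : ℕ → List Γ, V 0 ∈ I ∧ V w.length ∈ F ∧
      ∀ j a, w[j]? = some a → G.Edge (V j) a (V (j+1)) := by
  constructor
  · rintro ⟨vs, i, f, ⟨hl, hp⟩, hi, hI, hf, hF⟩
    refine ⟨fun j => vs[j]?.getD [], ?_, ?_, ?_⟩
    · rw [List.head?_eq_getElem?] at hi
      simpa [hi] using hI
    · rw [List.getLast?_eq_getElem?, hl] at hf
      simp at hf
      simpa [hf] using hF
    · intro j a hj
      have hjl : j < w.length := by
        by_contra h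
        rw [List.getElem?_eq_none (by omega)] at hj
        simp at hj
      apply hp j a _ _ hj
      · simp [List.getElem?_eq_getElem (show j < vs.length by omega)]
      · simp [List.getElem?_eq_getElem (show j + 1 < vs.length by omega)]
  · rintro ⟨V, hI, hF, hE⟩
    refine ⟨(List.range (w.length + 1)).map V, V 0, V w.length, ⟨by simp, ?_⟩, ?_, hI, ?_, hF⟩
    · intro k a u v hk hu hv
      simp only [List.getElem?_map, Option.map_eq_some_iff, List.getElem?_eq_some_iff, List.getElem_range] at hu hv
      obtain ⟨x, ⟨_, rfl⟩, rfl⟩ := hu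
      obtain ⟨x, ⟨_, rfl⟩, rfl⟩ := hv
      exact hE _ _ hk
    · simp [List.range_succ_eq_map]
    · simp [List.range_succ]

/-- Entry of the framed picture. -/
def picE {Λ : Type} (R : List (List Λ)) : ℕ → ℕ → Option Λ
  | i+1, j+1 => R[i]?.bind (fun r => r[j]?)
  | _, _ => none

theorem picE_zero_left {Λ : Type} (R : List (List Λ)) (j : ℕ) : picE R 0 j = none := by
  cases j <;> rfl
theorem picE_zero_right {Λ : Type} (R : List (List Λ)) (i : ℕ) : picE R i 0 = none := by
  cases i <;> rfl
theorem picE_succ {Λ : Type} (R : List (List Λ)) (i j : ℕ) :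
    picE R (i+1) (j+1) = R[i]?.bind (fun r => r[j]?) := rfl

theorem framed_get {Λ : Type} (R : List (List Λ)) (m : ℕ) (hm : ∀ r ∈ R, r.length = m)
    (i j : ℕ) : ((framed R m)[i]?.bind (fun r => r[j]?)) =
      if i ≤ R.length + 1 ∧ j ≤ m + 1 then some (picE R i j) else none := by
  have hrep : ∀ j, (List.replicate (m+2) (none : Option Λ))[j]? =
      if j ≤ m + 1 then some none else none := by
    intro j
    rw [List.getElem?_replicate]
    simp [Nat.lt_succ_iff]
  unfold framed
  rcases i with _ | i
  · simp [picE_zero_left, hrep]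
  · simp only [List.cons_append, List.getElem?_cons_succ]
    rcases lt_trichotomy i R.length with h | h | h
    · rw [List.getElem?_append_left (by simpa using h)]
      have hl := hm R[i] (List.getElem_mem h)
      simp only [List.getElem?_map, List.getElem?_eq_getElem h, Option.map_some, Option.bind_some]
      rcases j with _ | j
      · simp [picE_zero_right]; omega
      · rw [List.getElem?_cons_succ, picE_succ, List.getElem?_eq_getElem h]
        rcases lt_trichotomy j m with h' | h' | h'
        · rw [List.getElem?_append_left (by simp; omega)]
          simp [List.getElem?_eq_getElem (show j < R[i].length by omega)]
          omega
        · rw [List.getElem?_append_right (by simp; omega)]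
          simp [hl, h']
          omega
        · rw [List.getElem?_append_right (by simp; omega)]
          rw [List.getElem?_eq_none (by simp; omega)]
          rw [if_neg (by omega)]
    · subst h
      rw [List.getElem?_append_right (by simp)]
      have : picE R (R.length + 1) j = none := by
        cases j <;> simp [picE]
      simp [this, hrep]
    · rw [List.getElem?_append_right (by simp; omega), List.getElem?_eq_none (by simp; omega),
        if_neg (by omega)]
      rfl

theorem tiles_framed {Λ : Type} (R : List (List Λ)) (m : ℕ) (hm : ∀ r ∈ R, r.length = m)
    (T : Set (Tile (Option Λ))) : tilesOf (framed R m) ⊆ T ↔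
      ∀ i j, i ≤ R.length → j ≤ m →
        (⟨picE R i j, picE R i (j+1), picE R (i+1) j, picE R (i+1) (j+1)⟩ : Tile _) ∈ T := by
  have key := framed_get R m hm
  constructor
  · intro h i j hi hj
    apply h
    have hlen : (framed R m).length = R.length + 2 := by simp [framed]
    have h1 : i < (framed R m).length := by omega
    have h2 : i + 1 < (framed R m).length := by omega
    refine ⟨i, j, (framed R m)[i], (framed R m)[i+1], List.getElem?_eq_getElem h1,
      List.getElem?_eq_getElem h2, ?_, ?_, ?_, ?_⟩
    · have := key i j
      rw [List.getElem?_eq_getElem h1, if_pos (by omega)] at this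
      exact this
    · have := key i (j+1)
      rw [List.getElem?_eq_getElem h1, if_pos (by omega)] at this
      exact this
    · have := key (i+1) j
      rw [List.getElem?_eq_getElem h2, if_pos (by omega)] at this
      exact this
    · have := key (i+1) (j+1)
      rw [List.getElem?_eq_getElem h2, if_pos (by omega)] at this
      exact this
  · rintro h ⟨a, b, c, d⟩ ⟨i, j, r1, r2, h1, h2, ha, hb, hc, hd⟩
    have ka := key i j
    have kb := key i (j+1)
    have kc := key (i+1) j
    have kd := key (i+1) (j+1)
    rw [h1, Option.bind_some] at ka kb
    rw [h2, Option.bind_some] at kc kd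
    simp only at ha hb hc hd
    rw [ha] at ka
    rw [hb] at kb
    rw [hc] at kc
    rw [hd] at kd
    have hh : i + 1 ≤ R.length + 1 ∧ j + 1 ≤ m + 1 := by
      by_contra hn
      rw [if_neg hn] at kd
      cases kd
    rw [if_pos (by omega)] at ka kb kc kd
    have := h i j (by omega) (by omega)
    rw [← Option.some.inj ka, ← Option.some.inj kb, ← Option.some.inj kc,
      ← Option.some.inj kd] at this
    exact this

theorem TilingSystem.mem_lang {A Λ : Type} (S : TilingSystem A Λ) (w : List A) :
    w ∈ S.Lang ↔ ∃ R : List (List Λ), w ≠ [] ∧ R.head? = some (w.map S.emb) ∧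
      (∀ r ∈ R, r.length = w.length) ∧ ∀ i j, i ≤ R.length → j ≤ w.length →
        (⟨picE R i j, picE R i (j+1), picE R (i+1) j, picE R (i+1) (j+1)⟩ : Tile _) ∈ S.tiles := by
  constructor
  · rintro ⟨R, n, ⟨hn, hm, hl, hr, ht⟩, hh⟩
    exact ⟨R, List.length_pos_iff.1 hm, hh, hr, (tiles_framed R _ hr _).1 ht⟩
  · rintro ⟨R, hw, hh, hr, ht⟩
    refine ⟨R, R.length, ⟨?_, List.length_pos_iff.2 hw, rfl, hr, (tiles_framed R _ hr _).2 ht⟩, hh⟩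
    cases R
    · simp at hh
    · simp

/-! ## From tiling systems to sequential synchronous graphs -/

/-- Synchronous sequential transducer given by a partial transition function. -/
def mealy {Γ : Type} (Q : Type) (hQ : Fintype Q) (q0 : Q) (fin : Set Q)
    (δ : Q → Γ → Option (Γ × Q)) : Transducer Γ where
  Q := Q
  fintypeQ := hQ
  init := q0
  final := fin
  trans := fun q l q' => ∃ x y, l = (some x, some y) ∧ δ q x = some (y, q')

theorem mealy_sync {Γ : Type} (Q : Type) (hQ : Fintype Q) (q0 : Q) (fin : Set Q)
    (δ : Q → Γ → Option (Γ × Q)) : (mealy Q hQ q0 fin δ).Synchronous := by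
  rintro q q' l ⟨x, y, rfl, _⟩
  simp

theorem mealy_seq {Γ : Type} (Q : Type) (hQ : Fintype Q) (q0 : Q) (fin : Set Q)
    (δ : Q → Γ → Option (Γ × Q)) : (mealy Q hQ q0 fin δ).Sequential := by
  rintro q q' q'' x y x' y' ⟨a, b, h1, h2⟩ ⟨c, d, h3, h4⟩
  cases h1
  cases h3
  by_cases hac : a = c
  · subst hac
    rw [h2] at h4
    cases h4
    left
    simp
  · right
    simpa using hac

/-- Run of a partial Mealy machine. -/
def mrun {Γ Q : Type} (δ : Q → Γ → Option (Γ × Q)) : Q → List Γ → Option (List Γ × Q)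
  | q, [] => some ([], q)
  | q, x :: u => (δ q x).bind fun p => (mrun δ p.2 u).map fun r => (p.1 :: r.1, r.2)

theorem mealy_path {Γ : Type} (Q : Type) (hQ : Fintype Q) (q0 : Q) (fin : Set Q)
    (δ : Q → Γ → Option (Γ × Q)) (u v : List Γ) (q q' : Q) :
    (∃ ls, (mealy Q hQ q0 fin δ).Path q ls q' ∧ Transducer.ins ls = u ∧ Transducer.outs ls = v) ↔
      mrun δ q u = some (v, q') := by
  constructor
  · rintro ⟨ls, hp, rfl, rfl⟩
    have aux : ∀ (q q' : (mealy Q hQ q0 fin δ).Q) (ls : List (Option Γ × Option Γ)),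
        (mealy Q hQ q0 fin δ).Path q ls q' →
        mrun (Q := (mealy Q hQ q0 fin δ).Q) δ q (Transducer.ins ls) =
          some (Transducer.outs ls, q') := by
      intro q q' ls hp
      induction hp with
      | nil q => rfl
      | @cons a b c l ls ht hp ih =>
        obtain ⟨x, y, rfl, hd⟩ := ht
        simp only [Transducer.ins, Transducer.outs] at ih
        simp [Transducer.ins, Transducer.outs, mrun, hd]
        exact congrArg (Option.map fun r => (y :: r.1, r.2)) ih
    exact aux q q' ls hp
  · intro h
    induction u generalizing q v with
    | nil =>
      simp [mrun] at h
      obtain ⟨rfl, rfl⟩ := h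
      exact ⟨[], .nil _, rfl, rfl⟩
    | cons x u ih =>
      simp only [mrun, Option.bind_eq_some_iff, Option.map_eq_some_iff] at h
      obtain ⟨⟨y, q1⟩, h1, ⟨v1, q2⟩, h2, h3⟩ := h
      cases h3
      obtain ⟨ls, hp, hi, ho⟩ := ih _ _ h2
      refine ⟨(some x, some y) :: ls, .cons (q' := q1) ⟨x, y, rfl, h1⟩ hp, ?_, ?_⟩
      · rw [← hi]; simp [Transducer.ins]
      · rw [← ho]; simp [Transducer.outs]

theorem mealy_accepts {Γ : Type} (Q : Type) (hQ : Fintype Q) (q0 : Q) (fin : Set Q)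
    (δ : Q → Γ → Option (Γ × Q)) (u v : List Γ) :
    (mealy Q hQ q0 fin δ).Accepts u v ↔ ∃ q ∈ fin, mrun δ q0 u = some (v, q) := by
  constructor
  · rintro ⟨q, ls, hp, hq, hi, ho⟩
    exact ⟨q, hq, (mealy_path Q hQ q0 fin δ u v q0 q).1 ⟨ls, hp, hi, ho⟩⟩
  · rintro ⟨q, hq, h⟩
    obtain ⟨ls, hp, hi, ho⟩ := (mealy_path Q hQ q0 fin δ u v q0 q).2 h
    exact ⟨q, ls, hp, hq, hi, ho⟩

section Dir2

variable {A Λ : Type}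

/-- Vertex alphabet: a separator, or a letter with a mark bit. -/
abbrev VAlph (Λ : Type) := Option (Bool × Λ)

/-- Encoding of a row with `k` first letters marked, followed by `rest`. -/
def encRow : ℕ → List Λ → List (VAlph Λ) → List (VAlph Λ)
  | _, [], rest => none :: rest
  | 0, x :: r, rest => some (false, x) :: encRow 0 r rest
  | k+1, x :: r, rest => some (true, x) :: encRow k r rest

def enc (k : ℕ) : List (List Λ) → List (VAlph Λ)
  | [] => []
  | r :: R => encRow k r (enc k R)

/-- Two columns letters. -/
abbrev CPair (Λ : Type) := Option Λ × Option Λ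

def relT (S : TilingSystem A Λ) (c d : CPair Λ) : Prop :=
  (⟨c.1, c.2, d.1, d.2⟩ : Tile _) ∈ S.tiles

def relA (S : TilingSystem A Λ) (a : A) (c d : CPair Λ) : Prop :=
  relT S c d ∧ (c = (none, none) → d.2 = some (S.emb a))

abbrev MState (Λ : Type) := CPair Λ × (Option Λ ⊕ CPair Λ)

open Classical in
noncomputable def delta (S : TilingSystem A Λ) (a : A) :
    MState Λ → VAlph Λ → Option (VAlph Λ × MState Λ)
  | (top, .inl _), some (true, x) => some (some (true, x), (top, .inl (some x)))
  | (top, .inl p), some (false, x) =>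
      if relA S a top (p, some x) then some (some (true, x), (top, .inr (p, some x))) else none
  | (_, .inl _), none => none
  | (_, .inr _), some (true, _) => none
  | (top, .inr c), some (false, x) => some (some (false, x), (top, .inr c))
  | (_, .inr c), none => some (none, (c, .inl none))

/-- The pair of letters at position `k`, `k+1` in a row starting with `p`. -/
def cpair : Option Λ → ℕ → List Λ → CPair Λ
  | p, _, [] => (p, none)
  | p, 0, x :: _ => (p, some x)
  | _, k+1, x :: r => cpair (some x) k r

theorem mrun_inr (S : TilingSystem A Λ) (a : A) (top c : CPair Λ) (r : List Λ)
    (rest : List (VAlph Λ)) :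
    mrun (delta S a) (top, .inr c) (encRow 0 r rest) =
      (mrun (delta S a) (c, .inl none) rest).map fun z => (encRow 0 r [] ++ z.1, z.2) := by
  induction r with
  | nil => simp [encRow, mrun, delta]
  | cons x r ih =>
    simp only [encRow, mrun, delta, Option.bind_some, ih, Option.map_map]
    rfl

theorem encRow_append (k : ℕ) (r : List Λ) (rest : List (VAlph Λ)) :
    encRow k r [] ++ rest = encRow k r rest := by
  induction r generalizing k with
  | nil => simp [encRow]
  | cons x r ih => cases k <;> simp [encRow, ih]

theorem mrun_row (S : TilingSystem A Λ) (a : A) (top : CPair Λ) (p : Option Λ) (k : ℕ)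
    (r : List Λ) (rest v : List (VAlph Λ)) (q : MState Λ) :
    mrun (delta S a) (top, .inl p) (encRow k r rest) = some (v, q) ↔
      k < r.length ∧ relA S a top (cpair p k r) ∧
      ∃ v', mrun (delta S a) (cpair p k r, .inl none) rest = some (v', q) ∧
        v = encRow (k+1) r v' := by
  induction r generalizing p k v with
  | nil => simp [encRow, mrun, delta]
  | cons x r ih =>
    cases k with
    | zero =>
      simp only [encRow, mrun, delta, cpair]
      split_ifs with h
      · simp only [Option.bind_some, mrun_inr, Option.map_map, Option.map_eq_some_iff]
        simp only [List.length_cons, Nat.succ_pos, true_and, h]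
        constructor
        · rintro ⟨⟨v', q'⟩, h1, h2⟩
          cases h2
          exact ⟨v', h1, by simp [encRow_append]⟩
        · rintro ⟨v', h1, rfl⟩
          exact ⟨(v', q), h1, by simp [encRow_append]⟩
      · simp [h]
    | succ k =>
      simp only [encRow, mrun, delta, cpair, Option.bind_some, Option.map_eq_some_iff]
      constructor
      · rintro ⟨⟨v', q'⟩, h1, h2⟩
        cases h2
        obtain ⟨h3, h4, v'', h5, rfl⟩ := (ih _ _ _).1 h1
        exact ⟨by simpa using h3, h4, v'', h5, rfl⟩
      · rintro ⟨h3, h4, v'', h5, rfl⟩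
        exact ⟨(_, q), (ih _ _ _).2 ⟨by simpa using h3, h4, v'', h5, rfl⟩, rfl⟩

/-- Chain condition on a column. -/
def chk {X : Type} (rel : X → X → Prop) (bot : X) : X → List X → Prop
  | t, [] => rel t bot
  | t, x :: l => rel t x ∧ chk rel bot x l

theorem chk_iff {X : Type} (rel : X → X → Prop) (bot t : X) (l : List X) (D : ℕ → X)
    (h0 : D 0 = t) (h : ∀ i (hi : i < l.length), D (i+1) = l[i]) (hn : D (l.length + 1) = bot) :
    chk rel bot t l ↔ ∀ i ≤ l.length, rel (D i) (D (i+1)) := by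
  induction l generalizing t D with
  | nil => 
    simp only [chk, List.length_nil, Nat.le_zero, forall_eq, h0]
    simp only [List.length_nil] at hn
    rw [hn]
  | cons x l ih =>
    have h1 : D 1 = x := h 0 (by simp)
    rw [chk, ih x (fun i => D (i+1)) h1 (fun i hi => h (i+1) (Nat.succ_lt_succ hi))
      (by simpa using hn)]
    constructor
    · rintro ⟨h2, h3⟩ i hi
      cases i with
      | zero => rw [h0, h1]; exact h2
      | succ i => exact h3 i (by simpa using hi)
    · intro h2
      refine ⟨?_, fun i hi => h2 (i+1) (by simpa using hi)⟩
      have := h2 0 (by simp)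
      rwa [h0, h1] at this

def finA (S : TilingSystem A Λ) (a : A) : Set (MState Λ) :=
  {q | q.2 = .inl none ∧ relA S a q.1 (none, none)}

theorem mrun_enc (S : TilingSystem A Λ) (a : A) (top : CPair Λ) (k : ℕ)
    (R : List (List Λ)) (v : List (VAlph Λ)) :
    (∃ q ∈ finA S a, mrun (delta S a) (top, .inl none) (enc k R) = some (v, q)) ↔
      (∀ r ∈ R, k < r.length) ∧ chk (relA S a) (none, none) top (R.map (cpair none k)) ∧
        v = enc (k+1) R := by
  induction R generalizing top v with
  | nil =>
    simp only [enc, mrun, chk, List.map_nil]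
    constructor
    · rintro ⟨q, hq, h⟩
      cases h
      exact ⟨by simp, hq.2, rfl⟩
    · rintro ⟨_, h, rfl⟩
      exact ⟨_, ⟨rfl, h⟩, rfl⟩
  | cons r R ih =>
    simp only [enc, mrun_row, chk, List.map_cons, List.forall_mem_cons]
    constructor
    · rintro ⟨q, hq, h1, h2, v', h3, rfl⟩
      obtain ⟨h4, h5, rfl⟩ := (ih _ _).1 ⟨q, hq, h3⟩
      exact ⟨⟨h1, h4⟩, ⟨h2, h5⟩, rfl⟩
    · rintro ⟨⟨h1, h4⟩, ⟨h2, h5⟩, rfl⟩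
      obtain ⟨q, hq, h3⟩ := (ih _ _).2 ⟨h4, h5, rfl⟩
      exact ⟨q, hq, h1, h2, _, h3, rfl⟩

/-- The sequential synchronous graph of a tiling system. -/
noncomputable def graphOf [Fintype Λ] (S : TilingSystem A Λ) : RationalGraph A (VAlph Λ) where
  trans a := mealy (MState Λ) inferInstance ((none, none), .inl none) (finA S a) (delta S a)

/-- Initial vertices automaton. -/
def dfaI (Λ : Type) : DFA (VAlph Λ) (Option Bool) where
  start := some true
  accept := {some true}
  step q x := match q, x with
    | some _, none => some true
    | some _, some (false, _) => some false
    | _, _ => none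

theorem dfaI_none (u : List (VAlph Λ)) : (dfaI Λ).evalFrom none u = none := by
  induction u with
  | nil => rfl
  | cons x u ih => rw [DFA.evalFrom_cons]; exact ih

theorem dfaI_aux (u : List (VAlph Λ)) (b : Bool) (h : (dfaI Λ).evalFrom (some b) u = some true) :
    (b = true ∧ u = []) ∨ ∃ r R, u = encRow 0 r (enc 0 R) := by
  induction u generalizing b with
  | nil =>
    left
    simpa using h
  | cons x u ih =>
    right
    rw [DFA.evalFrom_cons] at h
    match x with
    | none =>
      rcases ih true h with ⟨_, rfl⟩ | ⟨r, R, rfl⟩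
      · exact ⟨[], [], rfl⟩
      · exact ⟨[], r :: R, rfl⟩
    | some (false, x) =>
      rcases ih false h with ⟨h, _⟩ | ⟨r, R, rfl⟩
      · cases h
      · exact ⟨x :: r, R, rfl⟩
    | some (true, x) =>
      have h : (dfaI Λ).evalFrom none u = some true := h
      rw [dfaI_none] at h
      cases h

theorem dfaI_row (r : List Λ) (rest : List (VAlph Λ)) (b : Bool) :
    (dfaI Λ).evalFrom (some b) (encRow 0 r rest) = (dfaI Λ).evalFrom (some true) rest := by
  induction r generalizing b with
  | nil => rfl
  | cons x r ih => rw [encRow, DFA.evalFrom_cons]; exact ih false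

theorem dfaI_enc (R : List (List Λ)) : (dfaI Λ).evalFrom (some true) (enc 0 R) = some true := by
  induction R with
  | nil => rfl
  | cons r R ih => rw [enc, dfaI_row, ih]

theorem mem_dfaI (u : List (VAlph Λ)) : u ∈ (dfaI Λ).accepts ↔ ∃ R, u = enc 0 R := by
  rw [DFA.mem_accepts]
  constructor
  · intro h
    rcases dfaI_aux u true h with ⟨_, rfl⟩ | ⟨r, R, rfl⟩
    · exact ⟨[], rfl⟩
    · exact ⟨r :: R, rfl⟩
  · rintro ⟨R, rfl⟩
    exact dfaI_enc R

def relF (S : TilingSystem A Λ) (c d : Option Λ) : Prop :=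
  relT S (c, none) (d, none) ∧ (c = none → d ≠ none)

open Classical in
/-- Final vertices automaton. -/
noncomputable def dfaF (S : TilingSystem A Λ) : DFA (VAlph Λ) (Option (CPair Λ)) where
  start := some (none, none)
  accept := {q | ∃ t, q = some (t, none) ∧ relF S t none}
  step q x := match q, x with
    | some (t, p), none => if p ≠ none ∧ relF S t p then some (p, none) else none
    | some (t, _), some (true, x) => some (t, some x)
    | _, _ => none

theorem dfaF_none (S : TilingSystem A Λ) (u : List (VAlph Λ)) :
    (dfaF S).evalFrom none u = none := by
  induction u with
  | nil => rfl
  | cons x u ih => rw [DFA.evalFrom_cons]; exact ih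

/-- The last letter of a row, with a default. -/
def lastD : Option Λ → List Λ → Option Λ
  | p, [] => p
  | _, x :: r => lastD (some x) r

theorem dfaF_row (S : TilingSystem A Λ) (k : ℕ) (t p : Option Λ) (r : List Λ)
    (rest : List (VAlph Λ)) :
    (dfaF S).evalFrom (some (t, p)) (encRow k r rest) ∈ (dfaF S).accept ↔
      r.length ≤ k ∧ lastD p r ≠ none ∧ relF S t (lastD p r) ∧
      (dfaF S).evalFrom (some (lastD p r, none)) rest ∈ (dfaF S).accept := by
  have hnone : ∀ u, ¬ (dfaF S).evalFrom none u ∈ (dfaF S).accept := by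
    intro u
    rw [dfaF_none]
    rintro ⟨t, h, _⟩
    cases h
  induction r generalizing p k with
  | nil =>
    rw [encRow, DFA.evalFrom_cons]
    by_cases h : p ≠ none ∧ relF S t p
    · have : (dfaF S).step (some (t, p)) none = some (p, none) := if_pos h
      rw [this]
      simp [lastD, h]
    · have : (dfaF S).step (some (t, p)) none = none := if_neg h
      rw [this]
      simp only [hnone, lastD, false_iff]
      tauto
  | cons x r ih =>
    cases k with
    | zero =>
      rw [encRow, DFA.evalFrom_cons]
      have : (dfaF S).step (some (t, p)) (some (false, x)) = none := rfl
      rw [this]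
      simp [hnone]
    | succ k =>
      rw [encRow, DFA.evalFrom_cons]
      have : (dfaF S).step (some (t, p)) (some (true, x)) = some (t, some x) := rfl
      rw [this]
      refine (ih k (some x)).trans ?_
      simp [lastD]

theorem dfaF_enc (S : TilingSystem A Λ) (k : ℕ) (t : Option Λ) (R : List (List Λ)) :
    (dfaF S).evalFrom (some (t, none)) (enc k R) ∈ (dfaF S).accept ↔
      (∀ r ∈ R, r.length ≤ k) ∧ (∀ r ∈ R, lastD none r ≠ none) ∧
        chk (relF S) none t (R.map (lastD none)) := by
  induction R generalizing t with
  | nil =>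
    simp only [enc, DFA.evalFrom_nil, List.map_nil, chk]
    constructor
    · rintro ⟨t', h, h2⟩
      cases h
      exact ⟨by simp, by simp, h2⟩
    · rintro ⟨_, _, h⟩
      exact ⟨t, rfl, h⟩
  | cons r R ih =>
    rw [enc, dfaF_row, ih]
    simp only [List.forall_mem_cons, List.map_cons, chk]
    tauto

theorem cpair_eq (p : Option Λ) (k : ℕ) (r : List Λ) (hk : k ≤ r.length) :
    cpair p k r = (if k = 0 then p else r[k-1]?, r[k]?) := by
  induction r generalizing p k with
  | nil =>
    have : k = 0 := by simpa using hk
    subst this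
    simp [cpair]
  | cons x r ih =>
    cases k with
    | zero => simp [cpair]
    | succ k =>
      rw [cpair, ih _ _ (by simpa using hk)]
      cases k <;> simp

theorem lastD_eq (p : Option Λ) (r : List Λ) :
    lastD p r = (cpair p r.length r).1 := by
  induction r generalizing p with
  | nil => rfl
  | cons x r ih => simp [lastD, cpair, ih]

theorem cpair_picE (R : List (List Λ)) (i k : ℕ) (hi : i < R.length) (hk : k ≤ R[i].length) :
    (picE R (i+1) k, picE R (i+1) (k+1)) = cpair none k R[i] := by
  rw [cpair_eq _ _ _ hk]
  cases k <;> simp [picE, hi]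

theorem picE_last (R : List (List Λ)) (k : ℕ) : picE R (R.length + 1) k = none := by
  cases k <;> simp [picE]

def setI (Λ : Type) : Set (List (VAlph Λ)) := {u | ∃ R, u = enc 0 R}

def setF (S : TilingSystem A Λ) : Set (List (VAlph Λ)) :=
  {u | (dfaF S).evalFrom (some (none, none)) u ∈ (dfaF S).accept}

theorem regular_setI : Regular (setI Λ) :=
  ⟨Option Bool, inferInstance, dfaI Λ, Set.ext fun u => mem_dfaI u⟩

theorem regular_setF [Fintype Λ] (S : TilingSystem A Λ) : Regular (setF S) :=
  ⟨Option (CPair Λ), inferInstance, dfaF S, rfl⟩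

theorem lang_graphOf [Fintype Λ] (S : TilingSystem A Λ) :
    (graphOf S).Lang (setI Λ) (setF S) = S.Lang := by
  ext w
  rw [RationalGraph.lang_fun, TilingSystem.mem_lang]
  have hedge : ∀ k R a v, (graphOf S).Edge (enc k R) a v ↔ _ := fun k R a v =>
    (mealy_accepts _ _ _ _ _ _ _).trans (mrun_enc S a (none, none) k R v)
  have hfin : ∀ k R, enc k R ∈ setF S ↔ _ := fun k R => dfaF_enc S k none R
  -- column checks in terms of `picE`
  have hcol : ∀ (rel : CPair Λ → CPair Λ → Prop) (R : List (List Λ)) (k : ℕ),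
      (∀ r ∈ R, k ≤ r.length) →
      (chk rel (none, none) (none, none) (R.map (cpair none k)) ↔ ∀ i ≤ R.length,
        rel (picE R i k, picE R i (k+1)) (picE R (i+1) k, picE R (i+1) (k+1))) := by
    intro rel R k hk
    rw [chk_iff rel (none, none) (none, none) (R.map (cpair none k))
      (fun i => (picE R i k, picE R i (k+1)))]
    · simp
    · simp [picE_zero_left]
    · intro i hi
      simp only [List.length_map] at hi
      simp only [List.getElem_map]
      exact cpair_picE R i k hi (hk _ (List.getElem_mem hi))
    · simp [picE_last]
  have hcolF : ∀ (R : List (List Λ)) (k : ℕ), (∀ r ∈ R, r.length = k) →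
      (chk (relF S) none none (R.map (lastD none)) ↔ ∀ i ≤ R.length,
        relF S (picE R i k) (picE R (i+1) k)) := by
    intro R k hk
    rw [chk_iff (relF S) none none (R.map (lastD none)) (fun i => picE R i k)]
    · simp
    · simp [picE_zero_left]
    · intro i hi
      simp only [List.length_map] at hi
      have hk' := hk _ (List.getElem_mem hi)
      simp only [List.getElem_map]
      rw [lastD_eq, hk', ← cpair_picE R i k hi hk'.ge]
    · simp [picE_last]
  have hout : ∀ (R : List (List Λ)) (k : ℕ), (∀ r ∈ R, r.length = k) → ∀ i,
      picE R i (k+1) = none := by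
    intro R k hk i
    cases i with
    | zero => rfl
    | succ i =>
      rw [picE_succ]
      by_cases hi : i < R.length
      · simp [hi, hk _ (List.getElem_mem hi)]
      · simp [List.getElem?_eq_none (Nat.le_of_not_lt hi)]
  constructor
  · rintro ⟨V, hI, hF, hE⟩
    obtain ⟨R, hR⟩ := hI
    have hV : ∀ j ≤ w.length, V j = enc j R := by
      intro j
      induction j with
      | zero => intro _; exact hR
      | succ j ih =>
        intro hj
        have h1 := hE j w[j] (List.getElem?_eq_getElem (by omega))
        rw [ih (by omega), hedge] at h1
        exact h1.2.2
    have hE' : ∀ j (hj : j < w.length), (∀ r ∈ R, j < r.length) ∧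
        chk (relA S w[j]) (none, none) (none, none) (R.map (cpair none j)) := by
      intro j hj
      have h1 := hE j w[j] (List.getElem?_eq_getElem (by omega))
      rw [hV j hj.le, hedge] at h1
      exact ⟨h1.1, h1.2.1⟩
    rw [hV _ le_rfl, hfin] at hF
    obtain ⟨hF1, hF2, hF3⟩ := hF
    have hRne : R ≠ [] := by
      rintro rfl
      exact hF3.2 rfl rfl
    obtain ⟨r0, R', hRR⟩ := List.exists_cons_of_ne_nil hRne
    have hw : w ≠ [] := by
      rintro rfl
      have h1 := hF1 r0 (by simp [hRR])
      have h2 := hF2 r0 (by simp [hRR])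
      simp at h1
      subst h1
      exact h2 rfl
    have hlen : ∀ r ∈ R, r.length = w.length := by
      intro r hr
      have h1 := hF1 r hr
      have hw' := List.length_pos_iff.2 hw
      have h2 := (hE' (w.length - 1) (by omega)).1 r hr
      omega
    refine ⟨R, hw, ?_, hlen, ?_⟩
    · rw [hRR]
      simp only [List.head?_cons, Option.some.injEq]
      have hl0 := hlen r0 (by simp [hRR])
      apply List.ext_getElem
      · simpa using hl0
      · intro j h1 h2
        have hjw : j < w.length := by omega
        have h3 := (hcol _ R j (fun r hr => by have := hlen r hr; omega)).1 (hE' j hjw).2 0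
          (by omega)
        have h4 := h3.2 (by simp [picE_zero_left])
        simpa [hRR, picE, h1] using h4
    · intro i j hi hj
      rcases Nat.lt_or_ge j w.length with hj' | hj'
      · exact ((hcol _ R j (fun r hr => by have := hlen r hr; omega)).1 (hE' j hj').2 i hi).1
      · have : j = w.length := by omega
        subst this
        rw [hout R _ hlen, hout R _ hlen]
        exact ((hcolF R _ hlen).1 hF3 i hi).1
  · rintro ⟨R, hw, hh, hlen, ht⟩
    have hw' := List.length_pos_iff.2 hw
    obtain ⟨R', rfl⟩ : ∃ R', R = w.map S.emb :: R' := by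
      cases R with
      | nil => simp at hh
      | cons r R' => exact ⟨R', by simpa using hh⟩
    set R := w.map S.emb :: R' with hRdef
    have hin : ∀ i j, i < R.length → j < w.length → picE R (i+1) (j+1) ≠ none := by
      intro i j hi hj
      have hl := hlen _ (List.getElem_mem hi)
      rw [picE_succ, List.getElem?_eq_getElem hi]
      simp only [Option.bind_some]
      rw [List.getElem?_eq_getElem (by omega)]
      simp
    refine ⟨fun j => enc j R, ⟨R, rfl⟩, ?_, ?_⟩
    · rw [hfin]
      refine ⟨fun r hr => (hlen r hr).le, ?_, ?_⟩
      · intro r hr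
        rw [lastD_eq, cpair_eq _ _ _ le_rfl, hlen r hr]
        rw [if_neg (by omega)]
        simp only
        rw [List.getElem?_eq_getElem (by rw [hlen r hr]; omega)]
        simp
      · rw [hcolF R _ hlen]
        intro i hi
        refine ⟨?_, ?_⟩
        · have := ht i w.length hi le_rfl
          rw [hout R _ hlen, hout R _ hlen] at this
          exact this
        · intro h
          obtain ⟨m, hm⟩ : ∃ m, w.length = m + 1 := ⟨w.length - 1, by omega⟩
          have hi0 : i = 0 := by
            by_contra hne
            obtain ⟨i', rfl⟩ := Nat.exists_eq_succ_of_ne_zero hne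
            rw [hm] at h
            exact hin i' m (by omega) (by omega) h
          subst hi0
          rw [hm]
          exact hin 0 m (by simp [hRdef]) (by omega)
    · intro j a hj
      have hjl : j < w.length := by
        by_contra h
        rw [List.getElem?_eq_none (by omega)] at hj
        simp at hj
      rw [hedge]
      refine ⟨fun r hr => by rw [hlen r hr]; exact hjl, ?_, rfl⟩
      rw [hcol _ R j (fun r hr => by rw [hlen r hr]; exact hjl.le)]
      intro i hi
      refine ⟨ht i j hi hjl.le, ?_⟩
      intro h
      have hi0 : i = 0 := by
        by_contra hne
        obtain ⟨i', rfl⟩ := Nat.exists_eq_succ_of_ne_zero hne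
        exact hin i' j (by omega) hjl (Prod.ext_iff.1 h).2
      subst hi0
      simp [picE, hRdef, hj]

end Dir2

/-! ## From synchronous graphs to tiling systems -/

section Dir1

variable {A Γ : Type}

/-- States of all the transducers of a graph. -/
abbrev GState (G : RationalGraph A Γ) := Σ a : A, (G.trans a).Q

def gtrans (G : RationalGraph A Γ) (k : GState G) (x : Γ × Γ) (k' : GState G) : Prop :=
  ∃ q', k' = ⟨k.1, q'⟩ ∧ (G.trans k.1).trans k.2 (some x.1, some x.2) q'

theorem path_of_states (G : RationalGraph A Γ) (a : A) (u v : List Γ) (huv : u.length = v.length)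
    (q : (G.trans a).Q) (k : ℕ → GState G) (h0 : k 0 = ⟨a, q⟩)
    (hs : ∀ i (hu : i < u.length) (hv : i < v.length), gtrans G (k i) (u[i], v[i]) (k (i+1))) :
    ∃ q' ls, k u.length = ⟨a, q'⟩ ∧ (G.trans a).Path q ls q' ∧ Transducer.ins ls = u ∧
      Transducer.outs ls = v := by
  induction u generalizing v q k with
  | nil =>
    cases v with
    | nil => exact ⟨q, [], h0, .nil _, rfl, rfl⟩
    | cons y v => simp at huv
  | cons x u ih =>
    cases v with
    | nil => simp at huv
    | cons y v =>
      have h1 := hs 0 (by simp) (by simp)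
      rw [h0] at h1
      obtain ⟨q1, h1, h2⟩ := h1
      obtain ⟨q', ls, h3, h4, h5, h6⟩ := ih v (by simpa using huv) q1 (fun i => k (i+1)) h1
        (fun i hu hv => hs (i+1) (Nat.succ_lt_succ hu) (Nat.succ_lt_succ hv))
      refine ⟨q', (some x, some y) :: ls, h3, .cons h2 h4, ?_, ?_⟩
      · rw [← h5]; simp [Transducer.ins]
      · rw [← h6]; simp [Transducer.outs]

theorem states_of_path (G : RationalGraph A Γ) (hG : G.Synchronous) (a : A)
    (q q' : (G.trans a).Q) (ls : List (Option Γ × Option Γ)) (hp : (G.trans a).Path q ls q') :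
    (Transducer.ins ls).length = (Transducer.outs ls).length ∧
    ∃ k : ℕ → GState G, k 0 = ⟨a, q⟩ ∧ k (Transducer.ins ls).length = ⟨a, q'⟩ ∧
      ∀ i (hu : i < (Transducer.ins ls).length) (hv : i < (Transducer.outs ls).length),
        gtrans G (k i) ((Transducer.ins ls)[i], (Transducer.outs ls)[i]) (k (i+1)) := by
  induction hp with
  | nil q =>
    refine ⟨rfl, fun _ => ⟨a, q⟩, rfl, rfl, ?_⟩
    intro i hu
    simp [Transducer.ins] at hu
  | @cons q q1 q2 l ls ht hp ih =>
    obtain ⟨hl, k, h0, h1, h2⟩ := ih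
    obtain ⟨x, y⟩ := l
    have hs := hG a _ _ _ ht
    obtain ⟨hx, hy⟩ := hs
    obtain ⟨x, rfl⟩ := Option.isSome_iff_exists.1 hx
    obtain ⟨y, rfl⟩ := Option.isSome_iff_exists.1 hy
    have e1 : Transducer.ins ((some x, some y) :: ls) = x :: Transducer.ins ls := by
      simp [Transducer.ins]
    have e2 : Transducer.outs ((some x, some y) :: ls) = y :: Transducer.outs ls := by
      simp [Transducer.outs]
    rw [e1, e2]
    refine ⟨by simpa using hl, fun i => if i = 0 then ⟨a, q⟩ else k (i-1), by simp, by simpa using h1, ?_⟩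
    intro i hu hv
    cases i with
    | zero => 
      refine ⟨q1, ?_, ht⟩
      simpa using h0
    | succ i => exact h2 i (Nat.lt_of_succ_lt_succ hu) (Nat.lt_of_succ_lt_succ hv)

/-- The initial state and acceptance. -/
def ginit (G : RationalGraph A Γ) (a : A) : GState G := ⟨a, (G.trans a).init⟩
def gfinal (G : RationalGraph A Γ) (k : GState G) : Prop := k.2 ∈ (G.trans k.1).final

theorem edge_iff (G : RationalGraph A Γ) (hG : G.Synchronous) (a : A) (u v : List Γ) :
    G.Edge u a v ↔ u.length = v.length ∧ ∃ k : ℕ → GState G, k 0 = ginit G a ∧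
      gfinal G (k u.length) ∧
      ∀ i (hu : i < u.length) (hv : i < v.length), gtrans G (k i) (u[i], v[i]) (k (i+1)) := by
  constructor
  · rintro ⟨q, ls, hp, hq, rfl, rfl⟩
    obtain ⟨h1, k, h2, h3, h4⟩ := states_of_path G hG a _ _ _ hp
    refine ⟨h1, k, h2, ?_, h4⟩
    rw [h3]
    exact hq
  · rintro ⟨h1, k, h2, h3, h4⟩
    obtain ⟨q', ls, h5, h6, h7, h8⟩ := path_of_states G a u v h1 _ k h2 h4
    rw [h5] at h3
    exact ⟨q', ls, h6, h3, h7, h8⟩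

variable {QI QF : Type}

/-- Full column states. -/
abbrev KState (G : RationalGraph A Γ) (QI QF : Type) := GState G × QI × QF

abbrev Cell (G : RationalGraph A Γ) (QI QF : Type) := A ⊕ ((Γ × Γ) × KState G QI QF)

variable (G : RationalGraph A Γ) (MI : DFA Γ QI) (MF : DFA Γ QF)

def cellOut : Cell G QI QF → KState G QI QF
  | .inl a => (ginit G a, MI.start, MF.start)
  | .inr c => c.2

def ktrans (k : KState G QI QF) (x : Γ × Γ) (k' : KState G QI QF) : Prop :=
  gtrans G k.1 x k'.1 ∧ k'.2.1 = MI.step k.2.1 x.1 ∧ k'.2.2 = MF.step k.2.2 x.2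

def relV : Option (Cell G QI QF) → Option (Cell G QI QF) → Prop
  | none, none => True
  | none, some (.inl _) => True
  | none, some (.inr _) => False
  | some _, some (.inl _) => False
  | some p, some (.inr c) => ktrans G MI MF (cellOut G MI MF p) c.1 c.2
  | some p, none => gfinal G (cellOut G MI MF p).1

def relH : Option (Cell G QI QF) → Option (Cell G QI QF) → Prop
  | some (.inr c), some (.inr d) => c.1.2 = d.1.1
  | _, _ => True

def tilingOf : TilingSystem A (Cell G QI QF) where
  emb := Sum.inl
  emb_inj := Sum.inl_injective
  tiles := {t | relV G MI MF t.tl t.bl ∧ relV G MI MF t.tr t.br ∧ relH G t.tl t.tr ∧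
    relH G t.bl t.br ∧
    (t.bl = none → t.br = none → t.tl = none → ∀ p, t.tr = some p →
      (cellOut G MI MF p).2.1 ∈ MI.accept) ∧
    (t.bl = none → t.br = none → t.tr = none → ∀ p, t.tl = some p →
      (cellOut G MI MF p).2.2 ∈ MF.accept)}

theorem dfa_states {Q : Type} (M : DFA Γ Q) (u : List Γ) (k : ℕ → Q) (h0 : k 0 = M.start)
    (hs : ∀ i (hu : i < u.length), k (i+1) = M.step (k i) u[i]) : k u.length = M.eval u := by
  have : ∀ i ≤ u.length, k i = M.eval (u.take i) := by
    intro i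
    induction i with
    | zero => intro _; simpa using h0
    | succ i ih =>
      intro hi
      rw [hs i (by omega), ih (by omega), List.take_succ_eq_append_getElem (by omega),
        DFA.eval_append_singleton]
  simpa using this _ le_rfl

theorem lang_of_tiling (hG : G.Synchronous) (w : List A) (hw : w ∈ (tilingOf G MI MF).Lang) :
    w ∈ G.Lang {u | MI.eval u ∈ MI.accept} {u | MF.eval u ∈ MF.accept} := by
  rw [TilingSystem.mem_lang] at hw
  obtain ⟨R, hw, hh, hlen, ht⟩ := hw
  have hm := List.length_pos_iff.2 hw
  obtain ⟨R', rfl⟩ : ∃ R', R = w.map Sum.inl :: R' := by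
    cases R with
    | nil => simp at hh
    | cons r R' => exact ⟨R', by simpa [tilingOf] using hh⟩
  set R := w.map Sum.inl :: R' with hR
  have hRl : R.length = R'.length + 1 := by simp [hR]
  have h0 : ∀ j (hj : j < w.length), picE R 1 (j+1) = some (.inl w[j]) := by
    intro j hj
    simp [picE, hR, hj]
  have hlen' : ∀ r ∈ R', r.length = w.length := fun r hr => hlen r (by simp [hR, hr])
  have hsome : ∀ i j, i < R.length → j < w.length → ∃ p, picE R (i+1) (j+1) = some p := by
    intro i j hi hj
    have hl := hlen _ (List.getElem_mem hi)
    exact ⟨R[i][j], by simp [picE, hi, hl, hj]⟩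
  have hcell : ∀ (i : Fin R'.length) (j : Fin w.length), ∃ c,
      picE R (i+2) (j+1) = some (.inr c) := by
    intro i j
    obtain ⟨p, hp⟩ := hsome (i+1) j (by omega) j.2
    obtain ⟨p', hp'⟩ := hsome i j (by omega) j.2
    have h1 := (ht (i+1) j (by omega) (by omega)).2.1
    simp only [hp, hp'] at h1
    cases p with
    | inl a => exact h1.elim
    | inr c => exact ⟨c, hp⟩
  choose C hC using hcell
  -- words
  let V : ℕ → List Γ := fun j => if h : j < w.length then List.ofFn fun i => (C i ⟨j, h⟩).1.1
    else List.ofFn fun i => (C i ⟨w.length - 1, by omega⟩).1.2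
  have hV1 : ∀ j (h : j < w.length), V j = List.ofFn fun i => (C i ⟨j, h⟩).1.1 :=
    fun j h => dif_pos h
  have hV2 : ∀ j (h : j < w.length), V (j+1) = List.ofFn fun i => (C i ⟨j, h⟩).1.2 := by
    intro j h
    by_cases h' : j + 1 < w.length
    · rw [hV1 _ h']
      congr 1
      funext i
      have h1 := (ht (i+2) (j+1) (by omega) (by omega)).2.2.1
      have e1 := hC i ⟨j, h⟩
      have e2 := hC i ⟨j+1, h'⟩
      simp only at e1 e2
      simp only [e1, e2] at h1
      exact h1.symm
    · have : V (j+1) = List.ofFn fun i => (C i ⟨w.length - 1, by omega⟩).1.2 := dif_neg h'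
      rw [this]
      have : j = w.length - 1 := by omega
      subst this
      rfl
  -- states
  have hk : ∀ j (h : j < w.length), ∃ k : ℕ → KState G QI QF,
      k 0 = (ginit G w[j], MI.start, MF.start) ∧
      (∀ i (hi : i < R'.length), ktrans G MI MF (k i) (C ⟨i, hi⟩ ⟨j, h⟩).1 (k (i+1))) ∧
      (∃ p, picE R (R'.length + 1) (j+1) = some p ∧ cellOut G MI MF p = k R'.length) := by
    intro j h
    refine ⟨fun i => ((picE R (i+1) (j+1)).map (cellOut G MI MF)).getD
      (ginit G w[j], MI.start, MF.start), ?_, ?_, ?_⟩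
    · simp [h0 j h, cellOut]
    · intro i hi
      obtain ⟨p, hp⟩ := hsome i j (by omega) h
      have h1 := (ht (i+1) j (by omega) h.le).2.1
      have e1 := hC ⟨i, hi⟩ ⟨j, h⟩
      simp only at e1
      simp only [hp, e1] at h1 ⊢
      exact h1
    · obtain ⟨p, hp⟩ := hsome R'.length j (by omega) h
      exact ⟨p, hp, by simp [hp]⟩
  have hbot : ∀ j, picE R (R'.length + 2) j = none := by
    intro j
    have := picE_last R j
    rwa [hRl] at this
  rw [RationalGraph.lang_fun]
  refine ⟨V, ?_, ?_, ?_⟩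
  · obtain ⟨k, hk0, hk1, p, hp, hk2⟩ := hk 0 hm
    have h1 := (ht (R'.length + 1) 0 (by omega) (by omega)).2.2.2.2.1 (hbot 0) (hbot 1) rfl p hp
    rw [hk2] at h1
    have h2 := dfa_states MI (V 0) (fun i => (k i).2.1) (by simp [hk0]) (by
      rw [hV1 0 hm]
      intro i hi
      simp only [List.length_ofFn] at hi
      simp only [List.getElem_ofFn]
      exact (hk1 i hi).2.1)
    rw [Set.mem_setOf_eq, ← h2, hV1 0 hm]
    simpa using h1
  · obtain ⟨m, hm'⟩ : ∃ m, w.length = m + 1 := ⟨w.length - 1, by omega⟩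
    have hmm : m < w.length := by omega
    obtain ⟨k, hk0, hk1, p, hp, hk2⟩ := hk m hmm
    have hout : picE R (R'.length + 1) (m+1+1) = none := by
      rw [picE_succ]
      have := hlen _ (List.getElem_mem (show R'.length < R.length by omega))
      rw [List.getElem?_eq_getElem (show R'.length < R.length by omega)]
      simp only [Option.bind_some]
      apply List.getElem?_eq_none
      omega
    have h1 := (ht (R'.length + 1) (m+1) (by omega) (by omega)).2.2.2.2.2 (hbot (m+1)) (hbot (m+1+1))
      hout p hp
    rw [hk2] at h1
    have h2 := dfa_states MF (V (m+1)) (fun i => (k i).2.2) (by simp [hk0]) (by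
      rw [hV2 m hmm]
      intro i hi
      simp only [List.length_ofFn] at hi
      simp only [List.getElem_ofFn]
      exact (hk1 i hi).2.2)
    rw [hm', Set.mem_setOf_eq, ← h2, hV2 m hmm]
    simpa using h1
  · intro j a hj
    obtain ⟨h, rfl⟩ := List.getElem?_eq_some_iff.1 hj
    obtain ⟨k, hk0, hk1, p, hp, hk2⟩ := hk j h
    rw [edge_iff G hG, hV1 j h, hV2 j h]
    refine ⟨by simp, fun i => (k i).1, by simp [hk0], ?_, ?_⟩
    · have h1 := (ht (R'.length + 1) j (by omega) h.le).2.1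
      simp only [hp, hbot] at h1
      simp only [List.length_ofFn]
      rw [← hk2]
      exact h1
    · intro i hi hi'
      simp only [List.length_ofFn] at hi
      simp only [List.getElem_ofFn]
      exact (hk1 i hi).1

theorem tiling_of_lang (hG : G.Synchronous) (w : List A) (hw : w ≠ [])
    (h : w ∈ G.Lang {u | MI.eval u ∈ MI.accept} {u | MF.eval u ∈ MF.accept}) :
    w ∈ (tilingOf G MI MF).Lang := by
  rw [RationalGraph.lang_fun] at h
  obtain ⟨V, hI, hF, hE⟩ := h
  have hm := List.length_pos_iff.2 hw
  have hE' : ∀ j : Fin w.length, _ := fun j =>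
    (edge_iff G hG _ _ _).1 (hE j w[j] (List.getElem?_eq_getElem j.2))
  have hl : ∀ j ≤ w.length, (V j).length = (V 0).length := by
    intro j
    induction j with
    | zero => intro _; rfl
    | succ j ih =>
      intro hj
      rw [← ih (by omega)]
      exact (hE' ⟨j, hj⟩).1.symm
  choose k hk0 hkf hks using fun j => (hE' j).2
  obtain ⟨ℓ, hℓ⟩ : ∃ ℓ, ℓ = (V 0).length := ⟨_, rfl⟩
  rw [← hℓ] at hl
  let K : Fin w.length → ℕ → KState G QI QF := fun j i =>
    (k j i, MI.eval ((V j).take i), MF.eval ((V (j+1)).take i))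
  let cell : Fin ℓ → Fin w.length → Cell G QI QF := fun i j =>
    .inr (((V j)[i.1]'(by rw [hl j j.2.le]; exact i.2),
      (V (j+1))[i.1]'(by rw [hl (j+1) j.2]; exact i.2)), K j (i+1))
  let R : List (List (Cell G QI QF)) :=
    w.map Sum.inl :: List.ofFn fun i => List.ofFn fun j => cell i j
  have hRl : R.length = ℓ + 1 := by simp [R]
  have hlen : ∀ r ∈ R, r.length = w.length := by
    intro r hr
    simp only [R, List.mem_cons, List.mem_ofFn] at hr
    rcases hr with rfl | ⟨i, rfl⟩ <;> simp
  have hP0 : ∀ j (hj : j < w.length), picE R 1 (j+1) = some (.inl w[j]) := by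
    intro j hj
    simp [picE, R, hj]
  have hP1 : ∀ i j (hi : i < ℓ) (hj : j < w.length),
      picE R (i+2) (j+1) = some (cell ⟨i, hi⟩ ⟨j, hj⟩) := by
    intro i j hi hj
    simp [picE, R, hi, hj]
  have hPr : ∀ i, picE R i (w.length + 1) = none := by
    intro i
    cases i with
    | zero => rfl
    | succ i =>
      rw [picE_succ]
      by_cases hi : i < R.length
      · simp [hi, hlen _ (List.getElem_mem hi)]
      · simp [List.getElem?_eq_none (Nat.le_of_not_lt hi)]
  have hPb : ∀ j, picE R (ℓ + 2) j = none := by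
    intro j
    have := picE_last R j
    rwa [hRl] at this
  have hout : ∀ i j (hi : i ≤ ℓ) (hj : j < w.length), ∃ p, picE R (i+1) (j+1) = some p ∧
      cellOut G MI MF p = K ⟨j, hj⟩ i := by
    intro i j hi hj
    cases i with
    | zero =>
      refine ⟨_, hP0 j hj, ?_⟩
      simp [cellOut, K, hk0]
    | succ i => exact ⟨_, hP1 i j hi hj, rfl⟩
  have hV : ∀ i j, i ≤ ℓ + 1 → j ≤ w.length + 1 →
      relV G MI MF (picE R i j) (picE R (i+1) j) := by
    intro i j hi hj
    rcases j with _ | j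
    · simp [picE_zero_right, relV]
    rcases Nat.lt_or_ge j w.length with hj' | hj'
    swap
    · have : j = w.length := by omega
      subst this
      simp [hPr, relV]
    rcases i with _ | i
    · rw [picE_zero_left, hP0 j hj']
      trivial
    obtain ⟨p, hp, hpo⟩ := hout i j (by omega) hj'
    rw [hp]
    rcases Nat.lt_or_ge i ℓ with hi' | hi'
    · rw [hP1 i j hi' hj']
      change ktrans G MI MF (cellOut G MI MF p) _ _
      rw [hpo]
      refine ⟨hks ⟨j, hj'⟩ i _ _, ?_, ?_⟩
      · simp only [K]
        rw [List.take_succ_eq_append_getElem (by rw [hl j hj'.le]; exact hi'),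
          DFA.eval_append_singleton]
      · simp only [K]
        rw [List.take_succ_eq_append_getElem (by rw [hl (j+1) hj']; exact hi'),
          DFA.eval_append_singleton]
    · have : i = ℓ := by omega
      subst this
      rw [hPb]
      change gfinal G (cellOut G MI MF p).1
      rw [hpo]
      have := hkf ⟨j, hj'⟩
      simp only [hl j hj'.le] at this
      exact this
  have hH : ∀ i j, i ≤ ℓ + 1 → j ≤ w.length → relH G (picE R i j) (picE R i (j+1)) := by
    intro i j hi hj
    rcases i with _ | _ | i
    · simp [picE_zero_left, relH]
    · rcases j with _ | j
      · simp [picE_zero_right, relH]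
      · rw [zero_add, hP0 j (by omega)]
        simp [relH]
    · rcases j with _ | j
      · simp [picE_zero_right, relH]
      · rcases Nat.lt_or_ge (j+1) w.length with hj' | hj'
        · rw [hP1 i j (by omega) (by omega), hP1 i (j+1) (by omega) hj']
          simp [cell, relH]
        · have : j + 1 = w.length := by omega
          rw [this, hPr]
          simp [relH]
  rw [TilingSystem.mem_lang]
  refine ⟨R, hw, rfl, hlen, ?_⟩
  intro i j hi hj
  rw [hRl] at hi
  have hbi : picE R (i+1) j = none → picE R (i+1) (j+1) = none → i = ℓ + 1 := by
    intro h1 h2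
    by_contra hne
    rcases Nat.lt_or_ge j w.length with hj' | hj'
    · obtain ⟨p, hp, _⟩ := hout i j (by omega) hj'
      rw [hp] at h2
      cases h2
    · obtain ⟨m, rfl⟩ : ∃ m, j = m + 1 := ⟨j - 1, by omega⟩
      obtain ⟨p, hp, _⟩ := hout i m (by omega) (by omega)
      rw [hp] at h1
      cases h1
  by_cases hib : i + 1 ≤ ℓ + 1
  · refine ⟨hV i j hi (by omega), hV i (j+1) hi (by omega), hH i j hi hj, hH (i+1) j hib hj, ?_, ?_⟩
    · intro h1 h2
      have := hbi h1 h2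
      omega
    · intro h1 h2
      have := hbi h1 h2
      omega
  · have : i = ℓ + 1 := by omega
    subst this
    refine ⟨hV _ j hi (by omega), hV _ (j+1) hi (by omega), hH _ j hi hj, ?_, ?_, ?_⟩
    · simp only [hPb]
      trivial
    · intro _ _ h1 p hp
      simp only at h1 hp
      rcases j with _ | j
      · obtain ⟨p', hp', hpo⟩ := hout ℓ 0 le_rfl hm
        rw [hp'] at hp
        cases hp
        rw [hpo]
        simp only [K, hℓ, List.take_length]
        exact hI
      · obtain ⟨p', hp', hpo⟩ := hout ℓ j le_rfl (by omega)
        rw [hp'] at h1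
        cases h1
    · intro _ _ h1 p hp
      simp only at h1 hp
      rcases Nat.lt_or_ge j w.length with hj' | hj'
      · obtain ⟨p', hp', hpo⟩ := hout ℓ j le_rfl hj'
        rw [hp'] at h1
        cases h1
      · obtain ⟨m, rfl⟩ : ∃ m, j = m + 1 := ⟨j - 1, by omega⟩
        obtain ⟨p', hp', hpo⟩ := hout ℓ m le_rfl (by omega)
        rw [hp'] at hp
        cases hp
        rw [hpo]
        have e : m + 1 = w.length := by omega
        simp only [K, e]
        rw [← hl w.length le_rfl, List.take_length]
        exact hF

end Dir1

/-- A language `L` of nonempty words is accepted by some sequential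
synchronous rational graph between rational sets of initial and final vertices iff `L`
is the word language of some tiling system; in particular, for every tiling system `S`
there are a sequential synchronous rational graph `G` and rational sets `I`, `F` with
`L(G,I,F) = L(S)`. -/
theorem sequential_synchronous_lang_iff_tiling {A : Type} [Fintype A] :
    (∀ L : Set (List A), (∀ w ∈ L, w ≠ []) →
      ((∃ (Γ : Type) (_ : Fintype Γ) (G : RationalGraph A Γ) (I F : Set (List Γ)),
          G.Synchronous ∧ G.Sequential ∧ Regular I ∧ Regular F ∧ G.Lang I F = L) ↔
        (∃ (Λ : Type) (_ : Fintype Λ) (S : TilingSystem A Λ), S.Lang = L))) ∧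
    (∀ (Λ : Type) (_ : Fintype Λ) (S : TilingSystem A Λ),
      ∃ (Γ : Type) (_ : Fintype Γ) (G : RationalGraph A Γ) (I F : Set (List Γ)),
        G.Synchronous ∧ G.Sequential ∧ Regular I ∧ Regular F ∧ G.Lang I F = S.Lang) := by
  classical
  have part2 : ∀ (Λ : Type) (_ : Fintype Λ) (S : TilingSystem A Λ),
      ∃ (Γ : Type) (_ : Fintype Γ) (G : RationalGraph A Γ) (I F : Set (List Γ)),
        G.Synchronous ∧ G.Sequential ∧ Regular I ∧ Regular F ∧ G.Lang I F = S.Lang := by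
    intro Λ _ S
    exact ⟨VAlph Λ, inferInstance, graphOf S, setI Λ, setF S,
      fun a => mealy_sync _ _ _ _ _, fun a => mealy_seq _ _ _ _ _,
      regular_setI, regular_setF S, lang_graphOf S⟩
  refine ⟨?_, part2⟩
  intro L hL
  constructor
  · rintro ⟨Γ, _, G, I, F, hG, _, ⟨QI, _, MI, rfl⟩, ⟨QF, _, MF, rfl⟩, rfl⟩
    have : ∀ a, Fintype (G.trans a).Q := fun a => (G.trans a).fintypeQ
    refine ⟨Cell G QI QF, inferInstance, tilingOf G MI MF, ?_⟩
    ext w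
    constructor
    · exact lang_of_tiling G MI MF hG w
    · intro h
      exact tiling_of_lang G MI MF hG w (hL w h) h
  · rintro ⟨Λ, _, S, rfl⟩
    exact part2 Λ inferInstance S
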